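/- Under the standing assumptions (Θ nonempty convex with K < ∞, C closed convex containing 0, C∩C^0 compact) and assuming the truncation function h is continuous, the map θ ↦ sup_{y∈C∩C^0} g^θ(y) is sequentially lower semicontinuous on Θ in the following sense: if θ_k = (b_k,c_k,F_k) ∈ Θ and θ = (b,c,F) ∈ Θ are such that b_k → b in ℝ^d, c_k → c in the matrices, and the finite measures |z|²∧1·F_k converge weakly (tested against bounded continuous functions on ℝ^d) to |z|²∧1·F, then liminf_{k→∞} sup_{y∈C∩C^0} g^{θ_k}(y) ≥ sup_{y∈C∩C^0} g^θ(y). -/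

import Mathlib

open MeasureTheory Filter Set
open scoped ENNReal NNReal Topology

noncomputable section

/-- The positive part of an extended real number, as an element of `ℝ≥0∞`. -/
def EReal.posPart (x : EReal) : ℝ≥0∞ := if x = ⊤ then ⊤ else ENNReal.ofReal x.toReal

/-- Integral of an `EReal`-valued function, defined as the difference of the lintegrals of
the positive and negative parts, with the conventions of `EReal` arithmetic
(in particular `∞ - ∞ = -∞`). -/
def eIntegral {α : Type*} [MeasurableSpace α] (F : Measure α) (f : α → EReal) : EReal :=
  ((∫⁻ z, (f z).posPart ∂F : ℝ≥0∞) : EReal) - ((∫⁻ z, (-(f z)).posPart ∂F : ℝ≥0∞) : EReal)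

/-- The dot product `y^⊤ z` on `ℝ^d`. -/
def dotp {d : ℕ} (y z : EuclideanSpace ℝ (Fin d)) : ℝ := ∑ i, y i * z i

/-- The quadratic form `y^⊤ c y`. -/
def quadf {d : ℕ} (c : Matrix (Fin d) (Fin d) ℝ) (y : EuclideanSpace ℝ (Fin d)) : ℝ :=
  ∑ i, ∑ j, c i j * y i * y j

/-- The (Frobenius) norm `|c|` of a matrix. -/
def matNorm {d : ℕ} (c : Matrix (Fin d) (Fin d) ℝ) : ℝ :=
  Real.sqrt (∑ i, ∑ j, (c i j) ^ 2)

/-- A Lévy measure on `ℝ^d`: a (Borel) measure with `F({0}) = 0` and `∫ |z|² ∧ 1 F(dz) < ∞`. -/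
def IsLevyMeasure {d : ℕ} (F : Measure (EuclideanSpace ℝ (Fin d))) : Prop :=
  F {0} = 0 ∧ ∫⁻ z, ENNReal.ofReal (min (‖z‖ ^ 2) 1) ∂F < ⊤

/-- A truncation function: bounded, measurable, equal to the identity near the origin. -/
structure IsTruncation {d : ℕ}
    (h : EuclideanSpace ℝ (Fin d) → EuclideanSpace ℝ (Fin d)) : Prop where
  measurable : Measurable h
  bounded : ∃ M : ℝ, ∀ z, ‖h z‖ ≤ M
  eq_id_near_zero : ∃ δ : ℝ, 0 < δ ∧ ∀ z, ‖z‖ < δ → h z = z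

/-- The integrand `I_y(z)`, as an extended real number:
`log(1+y^⊤z) - y^⊤h(z)` if `p = 0`, and `p⁻¹(1+y^⊤z)^p - p⁻¹ - y^⊤h(z)` if `p ≠ 0`,
with the conventions `log 0 = -∞` and `0^p = +∞` for `p < 0` (so that the integrand
is `-∞` on `{1 + y^⊤z ≤ 0}` when `p ≤ 0`). -/
def Ifun {d : ℕ} (p : ℝ) (h : EuclideanSpace ℝ (Fin d) → EuclideanSpace ℝ (Fin d))
    (y z : EuclideanSpace ℝ (Fin d)) : EReal :=
  if 0 < 1 + dotp y z then
    (if p = 0 then ((Real.log (1 + dotp y z) - dotp y (h z) : ℝ) : EReal)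
      else ((p⁻¹ * (1 + dotp y z) ^ p - p⁻¹ - dotp y (h z) : ℝ) : EReal))
  else if p ≤ 0 then (⊥ : EReal)
  else ((p⁻¹ * (1 + dotp y z) ^ p - p⁻¹ - dotp y (h z) : ℝ) : EReal)

/-- The function `g^{(b,c,F)}(y) = y^⊤b + ((p-1)/2)·y^⊤cy + ∫ I_y(z) F(dz)`. -/
def gfun {d : ℕ} (p : ℝ) (h : EuclideanSpace ℝ (Fin d) → EuclideanSpace ℝ (Fin d))
    (b : EuclideanSpace ℝ (Fin d)) (c : Matrix (Fin d) (Fin d) ℝ)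
    (F : Measure (EuclideanSpace ℝ (Fin d))) (y : EuclideanSpace ℝ (Fin d)) : EReal :=
  ((dotp y b + (p - 1) / 2 * quadf c y : ℝ) : EReal) + eIntegral F (fun z => Ifun p h y z)

/-- Triples `θ = (b, c, F)`. -/
abbrev Triple (d : ℕ) :=
  EuclideanSpace ℝ (Fin d) × Matrix (Fin d) (Fin d) ℝ × Measure (EuclideanSpace ℝ (Fin d))

/-- `g^θ(y)` for a triple `θ = (b,c,F)`. -/
def gTheta {d : ℕ} (p : ℝ) (h : EuclideanSpace ℝ (Fin d) → EuclideanSpace ℝ (Fin d))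
    (θ : Triple d) (y : EuclideanSpace ℝ (Fin d)) : EReal :=
  gfun p h θ.1 θ.2.1 θ.2.2 y

/-- The integrand appearing in the definition of the constant `K`, depending on `p`
(and an extra parameter `ε > 0` when `p ∈ (0,1)`). -/
def Kintegrand {d : ℕ} (p ε : ℝ) (z : EuclideanSpace ℝ (Fin d)) : ℝ :=
  if p = 0 then min (‖z‖ ^ 2) (Real.log (1 + ‖z‖))
  else if 0 < p then min (‖z‖ ^ 2) (‖z‖ ^ (p * (1 + ε)))
  else min (‖z‖ ^ 2) 1

/-- The natural constraints `C⁰ = ∩_{F ∈ L_Θ} {y : F({z : y^⊤z < -1}) = 0}`. -/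
def natC {d : ℕ} (Θ : Set (Triple d)) : Set (EuclideanSpace ℝ (Fin d)) :=
  {y | ∀ θ ∈ Θ, θ.2.2 {z | dotp y z < -1} = 0}

/-- The sets `C⁰ₙ = ∩_{F ∈ L_Θ} {y : F({z : y^⊤z < -1 + 1/n}) = 0}`. -/
def natCn {d : ℕ} (Θ : Set (Triple d)) (n : ℕ) : Set (EuclideanSpace ℝ (Fin d)) :=
  {y | ∀ θ ∈ Θ, θ.2.2 {z | dotp y z < -1 + 1 / (n : ℝ)} = 0}

/-- The finite measure `|z|² ∧ 1 · F`. -/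
def sq1Measure {d : ℕ} (F : Measure (EuclideanSpace ℝ (Fin d))) :
    Measure (EuclideanSpace ℝ (Fin d)) :=
  F.withDensity (fun z => ENNReal.ofReal (min (‖z‖ ^ 2) 1))

/-- The standing assumptions of the paper: `p = 0` or `p ∈ (-∞,0) ∪ (0,1)`, `ε > 0`,
`h` is a truncation function, `Θ` is a nonempty convex set of Lévy triplets with `K < ∞`,
`C` is closed, convex and contains `0`, and `C ∩ C⁰` is compact. -/
structure Standing {d : ℕ} (p ε : ℝ)
    (h : EuclideanSpace ℝ (Fin d) → EuclideanSpace ℝ (Fin d))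
    (Θ : Set (Triple d)) (C : Set (EuclideanSpace ℝ (Fin d))) : Prop where
  p_range : p = 0 ∨ p < 0 ∨ (0 < p ∧ p < 1)
  eps_pos : 0 < ε
  trunc : IsTruncation h
  Theta_nonempty : Θ.Nonempty
  Theta_psd : ∀ θ ∈ Θ, (θ.2.1).PosSemidef
  Theta_levy : ∀ θ ∈ Θ, IsLevyMeasure θ.2.2
  Theta_convex : ∀ θ₁ ∈ Θ, ∀ θ₂ ∈ Θ, ∀ t : ℝ, 0 ≤ t → t ≤ 1 →
    (t • θ₁.1 + (1 - t) • θ₂.1, t • θ₁.2.1 + (1 - t) • θ₂.2.1,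
      ENNReal.ofReal t • θ₁.2.2 + ENNReal.ofReal (1 - t) • θ₂.2.2) ∈ Θ
  K_finite : ∃ K : ℝ, ∀ θ ∈ Θ,
    (∫⁻ z, ENNReal.ofReal (Kintegrand p ε z) ∂θ.2.2) ≠ ⊤ ∧
    ‖θ.1‖ + matNorm θ.2.1 + (∫⁻ z, ENNReal.ofReal (Kintegrand p ε z) ∂θ.2.2).toReal ≤ K
  C_closed : IsClosed C
  C_convex : Convex ℝ C
  C_zero : (0 : EuclideanSpace ℝ (Fin d)) ∈ C
  CC0_compact : IsCompact (C ∩ natC Θ)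

/-- The utility function `log u` (for `p = 0`) or `(u ^ p - 1) / p` (for `p ≠ 0`). -/
def powUtility (p u : ℝ) : ℝ := if p = 0 then Real.log u else p⁻¹ * u ^ p - p⁻¹

lemma powUtility_one (p : ℝ) : powUtility p 1 = 0 := by
  simp [powUtility]

lemma hasDerivAt_powUtility (p : ℝ) {u : ℝ} (hu : 0 < u) :
    HasDerivAt (powUtility p) (u ^ (p - 1)) u := by
  by_cases hp : p = 0
  · have : powUtility p = Real.log := by ext; simp [powUtility, hp]
    rw [this, hp, zero_sub, Real.rpow_neg_one]
    exact Real.hasDerivAt_log hu.ne'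
  · have : powUtility p = fun u => p⁻¹ * u ^ p - p⁻¹ := by ext; simp [powUtility, hp]
    rw [this]
    have h1 := ((Real.hasDerivAt_rpow_const (p := p) (Or.inl hu.ne')).const_mul p⁻¹).sub_const p⁻¹
    rwa [← mul_assoc, inv_mul_cancel₀ hp, one_mul] at h1

lemma continuousOn_powUtility (p : ℝ) : ContinuousOn (powUtility p) (Ioi 0) :=
  fun _ hu => (hasDerivAt_powUtility p hu).continuousAt.continuousWithinAt

lemma monotoneOn_powUtility (p : ℝ) : MonotoneOn (powUtility p) (Ioi 0) := by
  refine monotoneOn_of_deriv_nonneg (convex_Ioi 0) (continuousOn_powUtility p) ?_ ?_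
  · rw [interior_Ioi]
    exact fun u hu => (hasDerivAt_powUtility p hu).differentiableAt.differentiableWithinAt
  · rw [interior_Ioi]
    intro u hu
    rw [(hasDerivAt_powUtility p hu).deriv]
    exact Real.rpow_nonneg (le_of_lt hu) _

lemma concaveOn_powUtility {p : ℝ} (hp : p ≤ 1) : ConcaveOn ℝ (Ioi 0) (powUtility p) := by
  refine AntitoneOn.concaveOn_of_deriv (convex_Ioi 0) (continuousOn_powUtility p) ?_ ?_
  · rw [interior_Ioi]
    exact fun u hu => (hasDerivAt_powUtility p hu).differentiableAt.differentiableWithinAt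
  · rw [interior_Ioi]
    intro u hu v hv huv
    rw [(hasDerivAt_powUtility p hu).deriv, (hasDerivAt_powUtility p hv).deriv]
    exact Real.rpow_le_rpow_of_nonpos hu huv (by linarith)

lemma mul_powUtility_le {p : ℝ} (hp : p ≤ 1) {s t : ℝ} (hs : 0 < 1 + s) (ht₀ : 0 ≤ t)
    (ht₁ : t ≤ 1) : t * powUtility p (1 + s) ≤ powUtility p (1 + t * s) := by
  have := (concaveOn_powUtility hp).2 (x := 1 + s) (y := 1) hs (mem_Ioi.2 one_pos) ht₀
    (sub_nonneg.2 ht₁) (by ring)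
  simp only [smul_eq_mul, powUtility_one, mul_zero, add_zero] at this
  rwa [show t * (1 + s) + (1 - t) * 1 = 1 + t * s by ring] at this

lemma exists_powUtility_one_add_ge (p : ℝ) :
    ∃ L ρ : ℝ, 0 ≤ L ∧ 0 < ρ ∧ ∀ s, |s| < ρ → s - L * s ^ 2 ≤ powUtility p (1 + s) := by
  have hO := (Real.hasDerivAt_rpow_const (x := (1 : ℝ)) (p := p - 1)
    (Or.inl one_ne_zero)).differentiableAt.isBigO_sub
  obtain ⟨L, hL, hO⟩ := hO.exists_nonneg
  obtain ⟨ρ, hρ, hO⟩ := Metric.eventually_nhds_iff.1 hO.bound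
  refine ⟨L, min ρ 1, hL, lt_min hρ one_pos, fun s hs => ?_⟩
  have hs' := lt_min_iff.1 hs
  have key := (convex_Icc (-|s|) |s|).norm_image_sub_le_of_norm_hasDerivWithin_le
    (f := fun x => powUtility p (1 + x) - x) (f' := fun x => (1 + x) ^ (p - 1) - 1)
    (C := L * |s|) (x := 0) (y := s) ?_ ?_ ⟨by simp, by simp⟩ ⟨neg_abs_le s, le_abs_self s⟩
  · simp only [add_zero, powUtility_one, sub_zero, Real.norm_eq_abs] at key
    have := neg_le_of_abs_le key
    have h2 : L * |s| * |s| = L * s ^ 2 := by rw [mul_assoc, abs_mul_abs_self, sq]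
    linarith
  · intro x hx
    have hx' : |x| ≤ |s| := abs_le.2 hx
    have hx1 : 0 < 1 + x := by have := neg_abs_le x; linarith
    have := (hasDerivAt_powUtility p hx1).comp_const_add 1 x
    exact (this.sub (hasDerivAt_id x)).hasDerivWithinAt
  · intro x hx
    have hx' : |x| ≤ |s| := abs_le.2 hx
    have := @hO (1 + x) (by simp; linarith)
    simp only [Real.one_rpow, add_sub_cancel_left, Real.norm_eq_abs] at this ⊢
    exact this.trans (mul_le_mul_of_nonneg_left hx' hL)

section WeakConvergence

variable {d : ℕ}

/-- The weight `|z|² ∧ 1`. -/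
def sqMinOne (z : EuclideanSpace ℝ (Fin d)) : ℝ := min (‖z‖ ^ 2) 1

lemma continuous_sqMinOne : Continuous (sqMinOne (d := d)) := by
  unfold sqMinOne; fun_prop

lemma sqMinOne_nonneg (z : EuclideanSpace ℝ (Fin d)) : 0 ≤ sqMinOne z :=
  le_min (by positivity) zero_le_one

lemma sqMinOne_pos {z : EuclideanSpace ℝ (Fin d)} (hz : z ≠ 0) : 0 < sqMinOne z :=
  lt_min (by positivity) one_pos

lemma isFiniteMeasure_sq1Measure {F : Measure (EuclideanSpace ℝ (Fin d))}
    (hF : IsLevyMeasure F) : IsFiniteMeasure (sq1Measure F) :=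
  isFiniteMeasure_withDensity hF.2.ne

lemma lintegral_mul_sqMinOne {F : Measure (EuclideanSpace ℝ (Fin d))} (hF : IsLevyMeasure F)
    {f : EuclideanSpace ℝ (Fin d) → ℝ} (hf : Continuous f) (hf₀ : ∀ z, 0 ≤ f z) {M : ℝ}
    (hM : ∀ z, f z ≤ M) :
    ∫⁻ z, ENNReal.ofReal (f z * sqMinOne z) ∂F = ENNReal.ofReal (∫ z, f z ∂(sq1Measure F)) := by
  have := isFiniteMeasure_sq1Measure hF
  have hint : Integrable f (sq1Measure F) :=
    Integrable.of_bound hf.aestronglyMeasurable M (Eventually.of_forall fun z => by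
      rw [Real.norm_eq_abs, abs_of_nonneg (hf₀ z)]; exact hM z)
  rw [ofReal_integral_eq_lintegral_ofReal hint (Eventually.of_forall hf₀), sq1Measure,
    lintegral_withDensity_eq_lintegral_mul _ (by fun_prop) (by fun_prop)]
  refine lintegral_congr fun z => ?_
  rw [ENNReal.ofReal_mul (hf₀ z), mul_comm]
  rfl

/-- Weak convergence of the measures `|z|² ∧ 1 · Fₖ` to `|z|² ∧ 1 · F`. -/
def TendstoSq1 (Fs : ℕ → Measure (EuclideanSpace ℝ (Fin d)))
    (F : Measure (EuclideanSpace ℝ (Fin d))) : Prop :=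
  ∀ f : EuclideanSpace ℝ (Fin d) → ℝ, Continuous f → (∃ M : ℝ, ∀ x, |f x| ≤ M) →
    Tendsto (fun k => ∫ z, f z ∂(sq1Measure (Fs k))) atTop (nhds (∫ z, f z ∂(sq1Measure F)))

variable {Fs : ℕ → Measure (EuclideanSpace ℝ (Fin d))} {F : Measure (EuclideanSpace ℝ (Fin d))}

lemma tendsto_lintegral_mul_sqMinOne (hFs : ∀ k, IsLevyMeasure (Fs k)) (hF : IsLevyMeasure F)
    (hw : TendstoSq1 Fs F)
    {f : EuclideanSpace ℝ (Fin d) → ℝ} (hf : Continuous f) (hf₀ : ∀ z, 0 ≤ f z) {M : ℝ}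
    (hM : ∀ z, f z ≤ M) :
    Tendsto (fun k => ∫⁻ z, ENNReal.ofReal (f z * sqMinOne z) ∂(Fs k)) atTop
      (nhds (∫⁻ z, ENNReal.ofReal (f z * sqMinOne z) ∂F)) := by
  rw [lintegral_mul_sqMinOne hF hf hf₀ hM]
  simp_rw [fun k => lintegral_mul_sqMinOne (hFs k) hf hf₀ hM]
  exact (ENNReal.continuous_ofReal.tendsto _).comp
    (hw f hf ⟨M, fun z => by rw [abs_of_nonneg (hf₀ z)]; exact hM z⟩)

lemma lintegral_le_liminf_of_tendstoSq1 (hFs : ∀ k, IsLevyMeasure (Fs k)) (hF : IsLevyMeasure F)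
    (hw : TendstoSq1 Fs F)
    {G : EuclideanSpace ℝ (Fin d) → ℝ} (hG : Continuous G) (hG₀ : ∀ z, 0 ≤ G z)
    (hGz : G 0 = 0) :
    ∫⁻ z, ENNReal.ofReal (G z) ∂F ≤
      liminf (fun k => ∫⁻ z, ENNReal.ofReal (G z) ∂(Fs k)) atTop := by
  set f : ℕ → EuclideanSpace ℝ (Fin d) → ℝ := fun n z =>
    min (G z) ((n + 1 : ℝ) * sqMinOne z) / max (sqMinOne z) (1 / (n + 1 : ℝ)) with hf
  have hden : ∀ (n : ℕ) (z : EuclideanSpace ℝ (Fin d)),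
      0 < max (sqMinOne z) (1 / (n + 1 : ℝ)) := fun n z => lt_max_of_lt_right (by positivity)
  have hfc : ∀ n, Continuous (f n) := fun n =>
    (hG.min (continuous_const.mul continuous_sqMinOne)).div
      (continuous_sqMinOne.max continuous_const) fun z => (hden n z).ne'
  have hf₀ : ∀ n z, 0 ≤ f n z := fun n z =>
    div_nonneg (le_min (hG₀ z) (mul_nonneg (by positivity) (sqMinOne_nonneg z))) (hden n z).le
  have hfM : ∀ n z, f n z ≤ (n + 1 : ℝ) := fun n z => by
    rw [hf, div_le_iff₀ (hden n z)]
    exact (min_le_right _ _).trans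
      (mul_le_mul_of_nonneg_left (le_max_left _ _) (by positivity))
  have hfG : ∀ n z, f n z * sqMinOne z ≤ G z := fun n z => by
    have h1 : f n z * max (sqMinOne z) (1 / (n + 1 : ℝ)) ≤ G z := by
      rw [hf, div_mul_cancel₀ _ (hden n z).ne']
      exact min_le_left _ _
    exact (mul_le_mul_of_nonneg_left (le_max_left _ _) (hf₀ n z)).trans h1
  have hlim : ∀ z, Tendsto (fun n => ENNReal.ofReal (f n z * sqMinOne z)) atTop
      (nhds (ENNReal.ofReal (G z))) := by
    intro z
    by_cases hz : z = 0
    · have : sqMinOne (0 : EuclideanSpace ℝ (Fin d)) = 0 := by simp [sqMinOne]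
      simp [this, hz, hGz]
    have hwz := sqMinOne_pos hz
    refine tendsto_const_nhds.congr' ?_
    filter_upwards [eventually_ge_atTop ⌈G z / sqMinOne z⌉₊,
      eventually_ge_atTop ⌈1 / sqMinOne z⌉₊] with n hn1 hn2
    have hn1' : G z ≤ (n + 1 : ℝ) * sqMinOne z := by
      rw [← div_le_iff₀ hwz]; exact (Nat.ceil_le.1 hn1).trans (by linarith)
    have hn2' : 1 / (n + 1 : ℝ) ≤ sqMinOne z := by
      rw [div_le_iff₀ (by positivity), mul_comm, ← div_le_iff₀ hwz]
      exact (Nat.ceil_le.1 hn2).trans (by linarith)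
    simp only [hf]
    rw [min_eq_left hn1', max_eq_left hn2', div_mul_cancel₀ _ hwz.ne']
  calc ∫⁻ z, ENNReal.ofReal (G z) ∂F
      = ∫⁻ z, liminf (fun n => ENNReal.ofReal (f n z * sqMinOne z)) atTop ∂F :=
        lintegral_congr fun z => (hlim z).liminf_eq.symm
    _ ≤ liminf (fun n => ∫⁻ z, ENNReal.ofReal (f n z * sqMinOne z) ∂F) atTop :=
        lintegral_liminf_le fun n =>
          ((hfc n).mul continuous_sqMinOne).measurable.ennreal_ofReal
    _ ≤ liminf (fun _ : ℕ =>
          liminf (fun k => ∫⁻ z, ENNReal.ofReal (G z) ∂(Fs k)) atTop) atTop := by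
        refine liminf_le_liminf (Eventually.of_forall fun n => ?_)
        rw [← (tendsto_lintegral_mul_sqMinOne hFs hF hw (hfc n) (hf₀ n) (hfM n)).liminf_eq]
        exact liminf_le_liminf (Eventually.of_forall fun k =>
          lintegral_mono fun z => ENNReal.ofReal_le_ofReal (hfG n z))
    _ = _ := liminf_const _

end WeakConvergence

section ExtendedIntegral

lemma EReal.posPart_coe (x : ℝ) : EReal.posPart (x : EReal) = ENNReal.ofReal x := by
  simp [EReal.posPart]

lemma EReal.posPart_neg_coe (x : ℝ) : EReal.posPart (-(x : EReal)) = ENNReal.ofReal (-x) := by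
  rw [← EReal.coe_neg, EReal.posPart_coe]

variable {α : Type*} [MeasurableSpace α] {F : Measure α}

lemma eIntegral_congr_ae {f g : α → EReal} (hfg : f =ᵐ[F] g) :
    eIntegral F f = eIntegral F g := by
  have h1 : ∫⁻ z, (f z).posPart ∂F = ∫⁻ z, (g z).posPart ∂F :=
    lintegral_congr_ae (hfg.fun_comp EReal.posPart)
  have h2 : ∫⁻ z, (-(f z)).posPart ∂F = ∫⁻ z, (-(g z)).posPart ∂F :=
    lintegral_congr_ae (hfg.fun_comp fun x => EReal.posPart (-x))
  rw [eIntegral, eIntegral, h1, h2]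

lemma mul_eIntegral_le {f g : α → EReal} {t : ℝ} (ht : 0 ≤ t)
    (hpos : ∀ᵐ z ∂F, ENNReal.ofReal t * (f z).posPart ≤ (g z).posPart)
    (hneg : ∀ᵐ z ∂F, (-(g z)).posPart ≤ ENNReal.ofReal t * (-(f z)).posPart) :
    (t : EReal) * eIntegral F f ≤ eIntegral F g := by
  have h1 := lintegral_mono_ae hpos
  have h2 := lintegral_mono_ae hneg
  rw [lintegral_const_mul' _ _ ENNReal.ofReal_ne_top] at h1 h2
  have ht' : ((ENNReal.ofReal t : ℝ≥0∞) : EReal) = t := by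
    rw [EReal.coe_ennreal_ofReal, max_eq_left ht]
  unfold eIntegral
  rw [sub_eq_add_neg, EReal.left_distrib_of_nonneg_of_ne_top (EReal.coe_nonneg.2 ht)
    (EReal.coe_ne_top t), mul_neg, ← sub_eq_add_neg, ← ht', ← EReal.coe_ennreal_mul,
    ← EReal.coe_ennreal_mul]
  exact EReal.sub_le_sub (EReal.coe_ennreal_le_coe_ennreal_iff.2 h1)
    (EReal.coe_ennreal_le_coe_ennreal_iff.2 h2)

lemma eIntegral_coe_eq_sub {J V : α → ℝ} (hJ : Measurable J) (hV : Measurable V)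
    (hV₀ : ∀ z, 0 ≤ V z) (hJV : ∀ z, -V z ≤ J z)
    (hfin : ∫⁻ z, ENNReal.ofReal (V z) ∂F ≠ ⊤) :
    eIntegral F (fun z => (J z : EReal)) =
      ((∫⁻ z, ENNReal.ofReal (J z + V z) ∂F : ℝ≥0∞) : EReal) -
        ((∫⁻ z, ENNReal.ofReal (V z) ∂F : ℝ≥0∞) : EReal) := by
  unfold eIntegral
  simp only [EReal.posPart_coe, EReal.posPart_neg_coe]
  have hle : ∫⁻ z, ENNReal.ofReal (-J z) ∂F ≤ ∫⁻ z, ENNReal.ofReal (V z) ∂F :=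
    lintegral_mono fun z => ENNReal.ofReal_le_ofReal (by linarith [hJV z])
  have hsum : ∫⁻ z, ENNReal.ofReal (J z) ∂F + ∫⁻ z, ENNReal.ofReal (V z) ∂F =
      ∫⁻ z, ENNReal.ofReal (J z + V z) ∂F + ∫⁻ z, ENNReal.ofReal (-J z) ∂F := by
    rw [← lintegral_add_right _ hV.ennreal_ofReal,
      ← lintegral_add_right _ (by fun_prop)]
    refine lintegral_congr fun z => ?_
    have := hJV z
    rcases le_total 0 (J z) with h0 | h0
    · rw [ENNReal.ofReal_of_nonpos (neg_nonpos.2 h0), add_zero, ENNReal.ofReal_add h0 (hV₀ z)]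
    · rw [ENNReal.ofReal_of_nonpos h0, zero_add,
        ← ENNReal.ofReal_add (by linarith) (by linarith)]
      congr 1
      ring
  generalize ∫⁻ z, ENNReal.ofReal (J z) ∂F = P at *
  generalize ∫⁻ z, ENNReal.ofReal (-J z) ∂F = N at *
  generalize ∫⁻ z, ENNReal.ofReal (V z) ∂F = W at *
  generalize ∫⁻ z, ENNReal.ofReal (J z + V z) ∂F = Q at *
  have hN : N ≠ ⊤ := ne_top_of_le_ne_top hfin hle
  lift N to ℝ≥0 using hN
  lift W to ℝ≥0 using hfin
  induction P with
  | top =>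
    have hQ : Q = ⊤ := by
      rw [top_add] at hsum
      exact (ENNReal.add_eq_top.1 hsum.symm).resolve_right ENNReal.coe_ne_top
    rw [hQ]
    rfl
  | coe P =>
    have hQ : Q ≠ ⊤ := fun hQ => by
      rw [hQ, top_add, ← ENNReal.coe_add] at hsum
      exact ENNReal.coe_ne_top hsum
    lift Q to ℝ≥0 using hQ
    norm_cast at hsum
    have : (P : ℝ) + W = Q + N := by exact_mod_cast hsum
    have h2 : (P : ℝ) - N = Q - W := by linarith
    simp only [EReal.coe_nnreal_eq_coe_real, ← EReal.coe_sub, h2]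

end ExtendedIntegral

section Integrand

variable {d : ℕ}

lemma dotp_eq_inner (y z : EuclideanSpace ℝ (Fin d)) : dotp y z = inner ℝ y z := by
  simp [dotp, PiLp.inner_apply, mul_comm]

lemma abs_dotp_le (y z : EuclideanSpace ℝ (Fin d)) : |dotp y z| ≤ ‖y‖ * ‖z‖ := by
  rw [dotp_eq_inner]; exact abs_real_inner_le_norm y z

lemma dotp_smul (t : ℝ) (y z : EuclideanSpace ℝ (Fin d)) : dotp (t • y) z = t * dotp y z := by
  rw [dotp_eq_inner, dotp_eq_inner, real_inner_smul_left]

lemma quadf_smul (c : Matrix (Fin d) (Fin d) ℝ) (t : ℝ) (y : EuclideanSpace ℝ (Fin d)) :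
    quadf c (t • y) = t ^ 2 * quadf c y := by
  simp only [quadf, PiLp.smul_apply, smul_eq_mul, Finset.mul_sum]
  refine Finset.sum_congr rfl fun i _ => Finset.sum_congr rfl fun j _ => by ring

variable {h : EuclideanSpace ℝ (Fin d) → EuclideanSpace ℝ (Fin d)}

lemma Ifun_of_pos (p : ℝ) {y z : EuclideanSpace ℝ (Fin d)} (hz : 0 < 1 + dotp y z) :
    Ifun p h y z = ((powUtility p (1 + dotp y z) - dotp y (h z) : ℝ) : EReal) := by
  unfold Ifun powUtility
  rw [if_pos hz]
  split_ifs <;> rfl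

/-- A globally defined continuous version of the integrand, obtained by cutting the wealth
`1 + y^⊤z` off from below at the level `η`. -/
def cutIntegrand (p η : ℝ) (h : EuclideanSpace ℝ (Fin d) → EuclideanSpace ℝ (Fin d))
    (y z : EuclideanSpace ℝ (Fin d)) : ℝ :=
  powUtility p (max (1 + dotp y z) η) - dotp y (h z)

lemma continuous_dotp (y : EuclideanSpace ℝ (Fin d)) : Continuous (dotp y) := by
  unfold dotp; fun_prop

lemma continuous_cutIntegrand (p : ℝ) {η : ℝ} (hη : 0 < η) (hcont : Continuous h)
    (y : EuclideanSpace ℝ (Fin d)) : Continuous (cutIntegrand p η h y) := by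
  refine Continuous.sub ?_ ((continuous_dotp y).comp hcont)
  exact (continuousOn_powUtility p).comp_continuous
    ((continuous_const.add (continuous_dotp y)).max continuous_const)
    fun z => lt_max_of_lt_right hη

lemma Ifun_eq_cutIntegrand (p : ℝ) {η : ℝ} (hη : 0 < η) {y z : EuclideanSpace ℝ (Fin d)}
    (hz : η ≤ 1 + dotp y z) : Ifun p h y z = (cutIntegrand p η h y z : EReal) := by
  rw [Ifun_of_pos p (hη.trans_le hz), cutIntegrand, max_eq_left hz]

lemma cutIntegrand_zero (p : ℝ) {η : ℝ} (hη : η ≤ 1) (hh : IsTruncation h)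
    (y : EuclideanSpace ℝ (Fin d)) : cutIntegrand p η h y 0 = 0 := by
  obtain ⟨δ, hδ, hid⟩ := hh.eq_id_near_zero
  have h0 : dotp y (0 : EuclideanSpace ℝ (Fin d)) = 0 := by simp [dotp]
  rw [cutIntegrand, hid 0 (by simpa using hδ), h0, add_zero, max_eq_left hη, powUtility_one,
    sub_zero]

lemma exists_le_cutIntegrand (p : ℝ) {η : ℝ} (hη : 0 < η) (hh : IsTruncation h)
    (y : EuclideanSpace ℝ (Fin d)) :
    ∃ A : ℝ, 0 ≤ A ∧ ∀ z, -(A * sqMinOne z) ≤ cutIntegrand p η h y z := by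
  obtain ⟨δ, hδ, hid⟩ := hh.eq_id_near_zero
  obtain ⟨M, hM⟩ := hh.bounded
  obtain ⟨L, ρ, hL, hρ, hLρ⟩ := exists_powUtility_one_add_ge p
  have hy : 0 < ‖y‖ + 1 := by positivity
  set r := min (min δ 1) (min ρ 1 / (‖y‖ + 1))
  have hr₀ : 0 < r := lt_min (lt_min hδ one_pos) (div_pos (lt_min hρ one_pos) hy)
  set B := |powUtility p η| + ‖y‖ * M
  have hM₀ : 0 ≤ M := (norm_nonneg _).trans (hM 0)
  have hB₀ : 0 ≤ B := by positivity
  have hm₀ : 0 < min (r ^ 2) 1 := lt_min (by positivity) one_pos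
  refine ⟨L * ‖y‖ ^ 2 + B / min (r ^ 2) 1, by positivity, fun z => ?_⟩
  have hw₀ := sqMinOne_nonneg z
  have hA₁ : 0 ≤ L * ‖y‖ ^ 2 * sqMinOne z := by positivity
  have hA₂ : 0 ≤ B / min (r ^ 2) 1 * sqMinOne z := by positivity
  rcases lt_or_ge ‖z‖ r with hz | hz
  · have hzδ : ‖z‖ < δ := hz.trans_le ((min_le_left _ _).trans (min_le_left _ _))
    have hz1 : ‖z‖ < 1 := hz.trans_le ((min_le_left _ _).trans (min_le_right _ _))
    have hs : |dotp y z| < min ρ 1 := by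
      have h1 : ‖z‖ * (‖y‖ + 1) < min ρ 1 := by
        rw [← lt_div_iff₀ hy]; exact hz.trans_le (min_le_right _ _)
      have h2 := abs_dotp_le y z
      nlinarith [norm_nonneg z]
    have hs1 := neg_lt_of_abs_lt (hs.trans_le (min_le_right _ _))
    have hw : sqMinOne z = ‖z‖ ^ 2 := min_eq_left (by nlinarith [norm_nonneg z])
    have hsq : dotp y z ^ 2 ≤ ‖y‖ ^ 2 * ‖z‖ ^ 2 := by
      rw [← mul_pow, ← sq_abs]
      exact pow_le_pow_left₀ (abs_nonneg _) (abs_dotp_le y z) 2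
    have hlow := hLρ _ (hs.trans_le (min_le_left _ _))
    have hmono : powUtility p (1 + dotp y z) ≤ powUtility p (max (1 + dotp y z) η) :=
      monotoneOn_powUtility p (by rw [mem_Ioi]; linarith) (lt_max_of_lt_right hη)
        (le_max_left _ _)
    have hLsq := mul_le_mul_of_nonneg_left hsq hL
    rw [cutIntegrand, hid z hzδ]
    rw [hw] at hA₂ ⊢
    linarith
  · have hw : min (r ^ 2) 1 ≤ sqMinOne z :=
      min_le_min_right _ (pow_le_pow_left₀ hr₀.le hz 2)
    have hBw : B ≤ B / min (r ^ 2) 1 * sqMinOne z := by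
      rw [div_mul_eq_mul_div, le_div_iff₀ hm₀]
      exact mul_le_mul_of_nonneg_left hw hB₀
    have hmono : powUtility p η ≤ powUtility p (max (1 + dotp y z) η) :=
      monotoneOn_powUtility p hη (lt_max_of_lt_right hη) (le_max_right _ _)
    have h1 := neg_abs_le (powUtility p η)
    have h2 := (le_abs_self _).trans ((abs_dotp_le y (h z)).trans
      (mul_le_mul_of_nonneg_left (hM z) (norm_nonneg y)))
    rw [cutIntegrand]
    linarith

lemma Ifun_smul_bounds {p : ℝ} (hp : p < 1) {y z : EuclideanSpace ℝ (Fin d)}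
    (hz : -1 ≤ dotp y z) {t : ℝ} (ht₀ : 0 < t) (ht₁ : t < 1) :
    ENNReal.ofReal t * (Ifun p h y z).posPart ≤ (Ifun p h (t • y) z).posPart ∧
      (-(Ifun p h (t • y) z)).posPart ≤ ENNReal.ofReal t * (-(Ifun p h y z)).posPart := by
  have hpos : 0 < 1 + dotp (t • y) z := by rw [dotp_smul]; nlinarith
  have hreal : ∀ s : ℝ, Ifun p h y z = s →
      t * s ≤ powUtility p (1 + dotp (t • y) z) - dotp (t • y) (h z) →
      ENNReal.ofReal t * (Ifun p h y z).posPart ≤ (Ifun p h (t • y) z).posPart ∧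
      (-(Ifun p h (t • y) z)).posPart ≤ ENNReal.ofReal t * (-(Ifun p h y z)).posPart := by
    intro s hs hle
    rw [Ifun_of_pos p hpos, hs, EReal.posPart_coe, EReal.posPart_coe, EReal.posPart_neg_coe,
      EReal.posPart_neg_coe, ← ENNReal.ofReal_mul ht₀.le, ← ENNReal.ofReal_mul ht₀.le]
    exact ⟨ENNReal.ofReal_le_ofReal hle, ENNReal.ofReal_le_ofReal (by linarith)⟩
  rcases hz.lt_or_eq with hz | hz
  · refine hreal _ (Ifun_of_pos p (by linarith)) ?_
    have := mul_powUtility_le hp.le (show 0 < 1 + dotp y z by linarith) ht₀.le ht₁.le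
    rw [dotp_smul, dotp_smul]
    linarith
  · have hz0 : 1 + dotp y z = 0 := by linarith
    rcases le_or_gt p 0 with hp0 | hp0
    · have : Ifun p h y z = ⊥ := by simp [Ifun, hz0, hp0]
      rw [this]
      have ht : ENNReal.ofReal t ≠ 0 := by simpa using ht₀
      simp [EReal.posPart, ENNReal.mul_top ht]
    · refine hreal (-p⁻¹ - dotp y (h z)) ?_ ?_
      · simp [Ifun, hz0, hp0.not_ge, Real.zero_rpow hp0.ne']
      · have hb : 1 - t ≤ (1 - t) ^ p := by
          simpa using
            Real.rpow_le_rpow_of_exponent_ge (by linarith : 0 < 1 - t) (by linarith) hp.le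
        have := mul_le_mul_of_nonneg_left hb (inv_nonneg.2 hp0.le)
        rw [dotp_smul, dotp_smul, ← hz, powUtility, if_neg hp0.ne',
          show 1 + t * -1 = 1 - t by ring]
        linarith

end Integrand

section LowerSemicontinuity

variable {d : ℕ} {h : EuclideanSpace ℝ (Fin d) → EuclideanSpace ℝ (Fin d)}

lemma continuous_quadf (y : EuclideanSpace ℝ (Fin d)) :
    Continuous (fun c : Matrix (Fin d) (Fin d) ℝ => quadf c y) := by
  unfold quadf
  fun_prop

/-- Lower semicontinuity in `θ` of `g^θ(y)` at a point `y` at which the wealth `1 + y^⊤z` is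
bounded away from zero. -/
lemma gTheta_le_liminf {p η : ℝ} (hη : 0 < η) (hη₁ : η ≤ 1) (hcont : Continuous h)
    (hh : IsTruncation h) {y : EuclideanSpace ℝ (Fin d)} {θseq : ℕ → Triple d} {θ : Triple d}
    (hFs : ∀ k, IsLevyMeasure (θseq k).2.2) (hF : IsLevyMeasure θ.2.2)
    (hys : ∀ k, ∀ᵐ z ∂(θseq k).2.2, η ≤ 1 + dotp y z) (hy : ∀ᵐ z ∂θ.2.2, η ≤ 1 + dotp y z)
    (hb : Tendsto (fun k => (θseq k).1) atTop (nhds θ.1))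
    (hc : Tendsto (fun k => (θseq k).2.1) atTop (nhds θ.2.1))
    (hw : TendstoSq1 (fun k => (θseq k).2.2) θ.2.2) :
    gTheta p h θ y ≤ liminf (fun k => gTheta p h (θseq k) y) atTop := by
  obtain ⟨A, hA, hlow⟩ := exists_le_cutIntegrand p hη hh y
  have hJ := continuous_cutIntegrand p hη hcont y
  have hG : Continuous fun z => cutIntegrand p η h y z + A * sqMinOne z :=
    hJ.add (continuous_const.mul continuous_sqMinOne)
  set Q : Measure (EuclideanSpace ℝ (Fin d)) → ℝ≥0∞ := fun F =>
    ∫⁻ z, ENNReal.ofReal (cutIntegrand p η h y z + A * sqMinOne z) ∂F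
  set W : Measure (EuclideanSpace ℝ (Fin d)) → ℝ := fun F => ∫ _, A ∂(sq1Measure F)
  have hWeq : ∀ {F}, IsLevyMeasure F →
      ∫⁻ z, ENNReal.ofReal (A * sqMinOne z) ∂F = ENNReal.ofReal (W F) := fun hF =>
    lintegral_mul_sqMinOne hF continuous_const (fun _ => hA) (fun _ => le_rfl)
  have hW₀ : ∀ F, 0 ≤ W F := fun F => integral_nonneg fun _ => hA
  have hg : ∀ θ' : Triple d, IsLevyMeasure θ'.2.2 → (∀ᵐ z ∂θ'.2.2, η ≤ 1 + dotp y z) →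
      gTheta p h θ' y = ((dotp y θ'.1 + (p - 1) / 2 * quadf θ'.2.1 y - W θ'.2.2 : ℝ) : EReal) +
        (Q θ'.2.2 : EReal) := by
    intro θ' hF' hy'
    have hI : (fun z => Ifun p h y z) =ᵐ[θ'.2.2] fun z => (cutIntegrand p η h y z : EReal) :=
      hy'.mono fun z hz => Ifun_eq_cutIntegrand p hη hz
    rw [gTheta, gfun, eIntegral_congr_ae hI, eIntegral_coe_eq_sub
      (V := fun z => A * sqMinOne z) hJ.measurable
      (continuous_const.mul continuous_sqMinOne).measurable
      (fun z => mul_nonneg hA (sqMinOne_nonneg z)) hlow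
      (by rw [hWeq hF']; exact ENNReal.ofReal_ne_top), hWeq hF', EReal.coe_ennreal_ofReal,
      max_eq_left (hW₀ _), EReal.coe_sub,
      sub_eq_add_neg (G := EReal), sub_eq_add_neg (G := EReal), add_assoc,
      add_comm (-(W θ'.2.2 : EReal))]
  rw [hg θ hF hy]
  simp_rw [fun k => hg (θseq k) (hFs k) (hys k)]
  have hWlim : Tendsto (fun k => W (θseq k).2.2) atTop (nhds (W θ.2.2)) :=
    hw _ continuous_const ⟨|A|, fun _ => le_rfl⟩
  have hreal : Tendsto (fun k => ((dotp y (θseq k).1 + (p - 1) / 2 * quadf (θseq k).2.1 y -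
      W (θseq k).2.2 : ℝ) : EReal)) atTop
      (nhds ((dotp y θ.1 + (p - 1) / 2 * quadf θ.2.1 y - W θ.2.2 : ℝ) : EReal)) :=
    (continuous_coe_real_ereal.tendsto _).comp
      (((((continuous_dotp y).tendsto _).comp hb).add
        ((((continuous_quadf y).tendsto _).comp hc).const_mul _)).sub hWlim)
  have hQlim : (Q θ.2.2 : EReal) ≤ liminf (fun k => (Q (θseq k).2.2 : EReal)) atTop := by
    have h1 := lintegral_le_liminf_of_tendstoSq1 hFs hF hw hG
      (fun z => by linarith [hlow z])
      (by simp [cutIntegrand_zero p hη₁ hh y, sqMinOne])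
    have h2 := Monotone.map_liminf_of_continuousAt (F := atTop)
      (f := ((↑) : ℝ≥0∞ → EReal)) (fun a b hab => EReal.coe_ennreal_le_coe_ennreal_iff.2 hab)
      (fun k => Q (θseq k).2.2) continuous_coe_ennreal_ereal.continuousAt
    exact (EReal.coe_ennreal_le_coe_ennreal_iff.2 h1).trans_eq h2
  calc _ ≤ _ := add_le_add hreal.liminf_eq.ge hQlim
    _ ≤ _ := EReal.le_liminf_add

/-- Quantitative concavity along the segment from the origin to a point `y` of the natural
constraints. -/
lemma le_gTheta_smul {p : ℝ} (hp : p < 1) {θ : Triple d} {y : EuclideanSpace ℝ (Fin d)}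
    (hy : ∀ᵐ z ∂θ.2.2, -1 ≤ dotp y z) {t : ℝ} (ht₀ : 0 < t) (ht₁ : t < 1) :
    ((t * dotp y θ.1 + (p - 1) / 2 * (t ^ 2 * quadf θ.2.1 y) : ℝ) : EReal) +
      t * eIntegral θ.2.2 (fun z => Ifun p h y z) ≤ gTheta p h θ (t • y) := by
  rw [gTheta, gfun, dotp_smul, quadf_smul]
  gcongr
  exact mul_eIntegral_le ht₀.le (hy.mono fun z hz => (Ifun_smul_bounds hp hz ht₀ ht₁).1)
    (hy.mono fun z hz => (Ifun_smul_bounds hp hz ht₀ ht₁).2)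

lemma gTheta_le_of_forall_smul_le {p : ℝ} (hp : p < 1) {θ : Triple d}
    {y : EuclideanSpace ℝ (Fin d)} (hy : ∀ᵐ z ∂θ.2.2, -1 ≤ dotp y z) {S : EReal}
    (hS : ∀ t : ℝ, 0 < t → t < 1 → gTheta p h θ (t • y) ≤ S) : gTheta p h θ y ≤ S := by
  have hle := fun t ht₀ ht₁ => (le_gTheta_smul (h := h) hp hy ht₀ ht₁).trans (hS t ht₀ ht₁)
  rw [gTheta, gfun]
  generalize eIntegral θ.2.2 (fun z => Ifun p h y z) = E at *
  induction E with
  | bot => simp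
  | top =>
    have := hle (1 / 2) (by norm_num) (by norm_num)
    rw [EReal.coe_mul_top_of_pos (by norm_num), EReal.coe_add_top, top_le_iff] at this
    simp [this]
  | coe E =>
    have hlim : Tendsto (fun t : ℝ => ((t * dotp y θ.1 + (p - 1) / 2 * (t ^ 2 * quadf θ.2.1 y) +
        t * E : ℝ) : EReal)) (𝓝[<] 1)
        (nhds ((1 * dotp y θ.1 + (p - 1) / 2 * (1 ^ 2 * quadf θ.2.1 y) + 1 * E : ℝ) : EReal)) :=
      (continuous_coe_real_ereal.comp (by fun_prop)).continuousAt.tendsto.mono_left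
        nhdsWithin_le_nhds
    have := le_of_tendsto (b := S) hlim (by
      filter_upwards [Ioo_mem_nhdsLT (zero_lt_one' ℝ)] with t ht
      simpa using hle t ht.1 ht.2)
    simpa using this

end LowerSemicontinuity

/-- Under the standing assumptions and with `h` continuous, the map
`θ ↦ sup_{y ∈ C ∩ C⁰} g^θ(y)` is sequentially lower semicontinuous on `Θ`: if
`θₖ = (bₖ,cₖ,Fₖ) ∈ Θ`, `θ = (b,c,F) ∈ Θ` are such that `bₖ → b`, `cₖ → c` and the finite
measures `|z|²∧1·Fₖ` converge weakly (tested against bounded continuous functions) to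
`|z|²∧1·F`, then `liminf_k sup_{y ∈ C ∩ C⁰} g^{θₖ}(y) ≥ sup_{y ∈ C ∩ C⁰} g^θ(y)`. -/
theorem stmt9 {d : ℕ} (hd : 1 ≤ d) (p ε : ℝ)
    (h : EuclideanSpace ℝ (Fin d) → EuclideanSpace ℝ (Fin d)) (hcont : Continuous h)
    (Θ : Set (Triple d)) (C : Set (EuclideanSpace ℝ (Fin d)))
    (SA : Standing p ε h Θ C)
    (θseq : ℕ → Triple d) (hθseq : ∀ k, θseq k ∈ Θ) (θ : Triple d) (hθ : θ ∈ Θ)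
    (hb : Tendsto (fun k => (θseq k).1) atTop (nhds θ.1))
    (hc : Tendsto (fun k => (θseq k).2.1) atTop (nhds θ.2.1))
    (hweak : ∀ f : EuclideanSpace ℝ (Fin d) → ℝ, Continuous f → (∃ M : ℝ, ∀ x, |f x| ≤ M) →
      Tendsto (fun k => ∫ z, f z ∂(sq1Measure (θseq k).2.2)) atTop
        (nhds (∫ z, f z ∂(sq1Measure θ.2.2)))) :
    (⨆ y ∈ C ∩ natC Θ, gTheta p h θ y) ≤
      Filter.liminf (fun k => ⨆ y ∈ C ∩ natC Θ, gTheta p h (θseq k) y) atTop := by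
  have hp : p < 1 := by
    rcases SA.p_range with hp | hp | hp
    · linarith
    · linarith
    · exact hp.2
  have hnat : ∀ y ∈ natC Θ, ∀ θ' ∈ Θ, ∀ᵐ z ∂θ'.2.2, -1 ≤ dotp y z := fun y hy θ' hθ' => by
    simpa [ae_iff] using hy θ' hθ'
  refine iSup₂_le fun y hy => gTheta_le_of_forall_smul_le hp (hnat y hy.2 θ hθ)
    fun t ht₀ ht₁ => ?_
  have hcut : ∀ θ' ∈ Θ, ∀ᵐ z ∂θ'.2.2, 1 - t ≤ 1 + dotp (t • y) z := fun θ' hθ' =>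
    (hnat y hy.2 θ' hθ').mono fun z hz => by rw [dotp_smul]; nlinarith
  have hmem : t • y ∈ C ∩ natC Θ := by
    refine ⟨SA.C_convex.smul_mem_of_zero_mem SA.C_zero hy.1 ⟨ht₀.le, ht₁.le⟩, fun θ' hθ' => ?_⟩
    have : ∀ᵐ z ∂θ'.2.2, -1 ≤ dotp (t • y) z := (hcut θ' hθ').mono fun z hz => by linarith
    simpa [ae_iff] using this
  calc gTheta p h θ (t • y)
      ≤ liminf (fun k => gTheta p h (θseq k) (t • y)) atTop :=
        gTheta_le_liminf (sub_pos.2 ht₁) (by linarith) hcont SA.trunc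
          (fun k => SA.Theta_levy _ (hθseq k)) (SA.Theta_levy _ hθ)
          (fun k => hcut _ (hθseq k)) (hcut _ hθ) hb hc hweak
    _ ≤ _ := liminf_le_liminf (Eventually.of_forall fun k =>
        le_iSup₂ (f := fun y (_ : y ∈ C ∩ natC Θ) => gTheta p h (θseq k) y) (t • y) hmem)
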